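/- Let A be the localization of ℂ[x_{ij} : 1 ≤ i,j ≤ 3] at the element x₁₃. Suppose {·,·} : A × A → A is ℂ-bilinear, is a derivation in each argument, and satisfies on generators {x_{ij}, x_{km}} = x_{im}x_{kj}(ε_{ik} + ε_{mj}) + 2δ_{im} Σ_{l>i} x_{kl}x_{lj} − 2δ_{jk} Σ_{l>j} x_{il}x_{lm} + x_{ij}x_{km}(δ_{im} − δ_{jk}), where ε_{ab} = sign(a−b). Define φ̄_α = x₁₃²(x₁₁x₂₃ − x₁₃x₂₁) + x₂₃, φ̄_β = x₃₂ − x₁₂x₁₃⁻³(1 + x₁₃²x₃₃), φ̄_γ = x₁₁ + x₂₂ + x₃₃ + x₁₃⁻², φ̄_t = x₁₃. Then for every t ∈ ℂ*, α, β, γ ∈ ℂ, evaluating at the point S(t,α,β,γ) = [[0,0,t],[0,−t⁻²,α],[t,β,γ]]: {φ̄_α, φ̄_β}(S) = 2(t² − t⁻⁴ − t⁻²γ), {φ̄_t, φ̄_α}(S) = tα, {φ̄_t, φ̄_β}(S) = −tβ, {φ̄_t, φ̄_γ}(S) = 0, {φ̄_γ, φ̄_α}(S) = −2t⁻²α, and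 {φ̄_γ, φ̄_β}(S) = 2t⁻²β. -/

import Mathlib

open MvPolynomial Matrix

/-- The polynomial ring `ℂ[x_{ij} : 1 ≤ i,j ≤ 3]`. -/
noncomputable abbrev PRing : Type := MvPolynomial (Fin 3 × Fin 3) ℂ

/-- The localization `A` of `ℂ[x_{ij}]` at the element `x₁₃`. -/
noncomputable abbrev ARing : Type := Localization.Away (X ((0 : Fin 3), (2 : Fin 3)) : PRing)

/-- The generator `x_{ij}` viewed in the localization `A`. -/
noncomputable def xv (i j : Fin 3) : ARing := algebraMap PRing ARing (X (i, j))

/-- `ε_{ab} = sign(a − b)`. -/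
noncomputable def eps (a b : Fin 3) : ℂ := if b < a then 1 else if a = b then 0 else -1

/-- The Kronecker delta `δ_{ab}`. -/
noncomputable def kdelta (a b : Fin 3) : ℂ := if a = b then 1 else 0

/-- The slice element `S(t,α,β,γ)`. -/
noncomputable def Smat (t α β γ : ℂ) : Matrix (Fin 3) (Fin 3) ℂ :=
  !![0, 0, t; 0, -(t ^ 2)⁻¹, α; t, β, γ]

/-- `φ̄_α = x₁₃²(x₁₁x₂₃ − x₁₃x₂₁) + x₂₃`. -/
noncomputable def phiA : ARing :=
  xv 0 2 ^ 2 * (xv 0 0 * xv 1 2 - xv 0 2 * xv 1 0) + xv 1 2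

/-- `φ̄_β = x₃₂ − x₁₂ x₁₃⁻³ (1 + x₁₃² x₃₃)`, where `u = x₁₃⁻¹`. -/
noncomputable def phiB (u : ARing) : ARing :=
  xv 2 1 - xv 0 1 * u ^ 3 * (1 + xv 0 2 ^ 2 * xv 2 2)

/-- `φ̄_γ = x₁₁ + x₂₂ + x₃₃ + x₁₃⁻²`, where `u = x₁₃⁻¹`. -/
noncomputable def phiG (u : ARing) : ARing :=
  xv 0 0 + xv 1 1 + xv 2 2 + u ^ 2

/-- `φ̄_t = x₁₃`. -/
noncomputable def phiT : ARing := xv 0 2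

section PointDerivation

variable {ev : ARing →+* ℂ} {D : ARing → ℂ}

private lemma pointDerivation_one (hmul : ∀ a b, D (a * b) = ev a * D b + D a * ev b) :
    D 1 = 0 := by
  simpa using hmul 1 1

private lemma pointDerivation_sub (hadd : ∀ a b, D (a + b) = D a + D b) (a b : ARing) :
    D (a - b) = D a - D b :=
  map_sub (AddMonoidHom.mk' D hadd) a b

private lemma pointDerivation_pow (hmul : ∀ a b, D (a * b) = ev a * D b + D a * ev b)
    (a : ARing) (n : ℕ) : D (a ^ (n + 1)) = (n + 1) * ev a ^ n * D a := by
  induction n with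
  | zero => simp
  | succ n ih =>
    rw [pow_succ, hmul, ih, map_pow]
    push_cast
    ring

private lemma pointDerivation_sq (hmul : ∀ a b, D (a * b) = ev a * D b + D a * ev b)
    (a : ARing) : D (a ^ 2) = 2 * ev a * D a := by
  rw [pointDerivation_pow hmul a 1]
  norm_num

variable {t α β γ : ℂ} {u : ARing}

private lemma ev_inverse (hev : ∀ i j, ev (xv i j) = Smat t α β γ i j)
    (hu : u * xv 0 2 = 1) : ev u = t⁻¹ := by
  have h := congrArg ev hu
  rw [map_mul, map_one, hev] at h
  exact eq_inv_of_mul_eq_one_left (by simpa [Smat] using h)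

private lemma pointDerivation_inverse (ht : t ≠ 0)
    (hmul : ∀ a b, D (a * b) = ev a * D b + D a * ev b)
    (hev : ∀ i j, ev (xv i j) = Smat t α β γ i j) (hu : u * xv 0 2 = 1) :
    D u = -(t ^ 2)⁻¹ * D (xv 0 2) := by
  have h := hmul u (xv 0 2)
  rw [hu, pointDerivation_one hmul, ev_inverse hev hu, hev] at h
  simp only [Smat, of_apply, cons_val] at h
  field_simp at h ⊢
  linear_combination -h

private lemma pointDerivation_phiA (hadd : ∀ a b, D (a + b) = D a + D b)
    (hmul : ∀ a b, D (a * b) = ev a * D b + D a * ev b)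
    (hev : ∀ i j, ev (xv i j) = Smat t α β γ i j) :
    D phiA = t ^ 2 * α * D (xv 0 0) - t ^ 3 * D (xv 1 0) + D (xv 1 2) := by
  simp [phiA, hadd, hmul, pointDerivation_sub hadd, pointDerivation_sq hmul, hev, Smat]
  ring

private lemma pointDerivation_phiB (hadd : ∀ a b, D (a + b) = D a + D b)
    (hmul : ∀ a b, D (a * b) = ev a * D b + D a * ev b)
    (hev : ∀ i j, ev (xv i j) = Smat t α β γ i j) (hu : u * xv 0 2 = 1) :
    D (phiB u) = D (xv 2 1) - (t ^ 3)⁻¹ * (1 + t ^ 2 * γ) * D (xv 0 1) := by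
  simp [phiB, hmul, pointDerivation_sub hadd, hev, Smat, ev_inverse hev hu]
  ring

private lemma pointDerivation_phiG (ht : t ≠ 0) (hadd : ∀ a b, D (a + b) = D a + D b)
    (hmul : ∀ a b, D (a * b) = ev a * D b + D a * ev b)
    (hev : ∀ i j, ev (xv i j) = Smat t α β γ i j) (hu : u * xv 0 2 = 1) :
    D (phiG u) = D (xv 0 0) + D (xv 1 1) + D (xv 2 2) - 2 * (t ^ 3)⁻¹ * D (xv 0 2) := by
  rw [phiG, hadd, hadd, hadd, pointDerivation_sq hmul, ev_inverse hev hu,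
    pointDerivation_inverse ht hmul hev hu]
  field_simp
  ring

end PointDerivation

/-- Let `{·,·}` be a ℂ-bilinear bracket on the localization `A` of
`ℂ[x_{ij}]` at `x₁₃`, a derivation in each argument, given on generators by formula (4.7).
Then evaluating at a slice point `S(t,α,β,γ)` (via any ring homomorphism `ev : A → ℂ`
fixing constants and sending `x_{ij}` to the entries of `S`), the brackets of the
`N`-invariant extensions `φ̄_α, φ̄_β, φ̄_γ, φ̄_t` take the values of formula (4.9). -/
theorem stmt_12 (B : ARing → ARing → ARing)
    (hadd_l : ∀ a b c : ARing, B (a + b) c = B a c + B b c)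
    (hadd_r : ∀ a b c : ARing, B a (b + c) = B a b + B a c)
    (hsmul_l : ∀ (r : ℂ) (a b : ARing), B (r • a) b = r • B a b)
    (hsmul_r : ∀ (r : ℂ) (a b : ARing), B a (r • b) = r • B a b)
    (hder_l : ∀ a b c : ARing, B (a * b) c = a * B b c + B a c * b)
    (hder_r : ∀ a b c : ARing, B a (b * c) = B a b * c + b * B a c)
    (hgen : ∀ i j k m : Fin 3,
      B (xv i j) (xv k m) =
        algebraMap PRing ARing (C (eps i k + eps m j)) * (xv i m * xv k j)
          + algebraMap PRing ARing (C (2 * kdelta i m)) *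
            (∑ l ∈ Finset.univ.filter (fun l => i < l), xv k l * xv l j)
          - algebraMap PRing ARing (C (2 * kdelta j k)) *
            (∑ l ∈ Finset.univ.filter (fun l => j < l), xv i l * xv l m)
          + algebraMap PRing ARing (C (kdelta i m - kdelta j k)) * (xv i j * xv k m))
    (u : ARing) (hu : u * xv 0 2 = 1)
    (t α β γ : ℂ) (ht : t ≠ 0)
    (ev : ARing →+* ℂ)
    (hevC : ∀ c : ℂ, ev (algebraMap PRing ARing (C c)) = c)
    (hev : ∀ i j : Fin 3, ev (xv i j) = Smat t α β γ i j) :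
    ev (B phiA (phiB u)) = 2 * (t ^ 2 - (t ^ 4)⁻¹ - (t ^ 2)⁻¹ * γ) ∧
    ev (B phiT phiA) = t * α ∧
    ev (B phiT (phiB u)) = -(t * β) ∧
    ev (B phiT (phiG u)) = 0 ∧
    ev (B (phiG u) phiA) = -(2 * (t ^ 2)⁻¹ * α) ∧
    ev (B (phiG u) (phiB u)) = 2 * (t ^ 2)⁻¹ * β := by
  have hl : ∀ c a b, ev (B (a * b) c) = ev a * ev (B b c) + ev (B a c) * ev b := by
    simp [hder_l]
  have hr : ∀ c a b, ev (B c (a * b)) = ev a * ev (B c b) + ev (B c a) * ev b := by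
    intro c a b
    rw [hder_r, map_add, map_mul, map_mul, add_comm]
  have hal : ∀ c a b, ev (B (a + b) c) = ev (B a c) + ev (B b c) := by simp [hadd_l]
  have har : ∀ c a b, ev (B c (a + b)) = ev (B c a) + ev (B c b) := by simp [hadd_r]
  have hAl c := pointDerivation_phiA (D := fun a => ev (B a c)) (hal c) (hl c) hev
  have hAr c := pointDerivation_phiA (D := fun a => ev (B c a)) (har c) (hr c) hev
  have hBr c := pointDerivation_phiB (D := fun a => ev (B c a)) (har c) (hr c) hev hu
  have hGl c := pointDerivation_phiG (D := fun a => ev (B a c)) ht (hal c) (hl c) hev hu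
  have hGr c := pointDerivation_phiG (D := fun a => ev (B c a)) ht (har c) (hr c) hev hu
  have hx : ∀ i j k m, ev (B (xv i j) (xv k m)) =
      (eps i k + eps m j) * (Smat t α β γ i m * Smat t α β γ k j)
        + 2 * kdelta i m * ∑ l, (if i < l then Smat t α β γ k l * Smat t α β γ l j else 0)
        - 2 * kdelta j k * ∑ l, (if j < l then Smat t α β γ i l * Smat t α β γ l m else 0)
        + (kdelta i m - kdelta j k) * (Smat t α β γ i j * Smat t α β γ k m) := by
    intro i j k m
    simp only [hgen, map_add, map_sub ev, map_mul ev, map_sum, hevC, hev,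
      ← Finset.sum_filter]
  refine ⟨?_, ?_, ?_, ?_, ?_, ?_⟩ <;>
    simp only [phiT, hAl, hAr, hBr, hGl, hGr, hx] <;>
    simp [eps, kdelta, Smat, Fin.sum_univ_three] <;>
    field_simp <;> ring
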